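/- Let 0 ≤ θ₁, θ₂, θ₃ < 1 with θ₁ + θ₂ + θ₃ = 1. There is a constant C depending only on θ₁, θ₂, θ₃ such that for every finite collection 𝐏 of quartiles and every choice, for each P ∈ 𝐏 and j = 1,2,3, of a measurable function F^{(j)}_P with a^{(j)}_{P_j} := ⟨F^{(j)}_P, φ_{P_j}⟩, one has |Σ_{P∈𝐏} |I_P|^{−1/2} a^{(1)}_{P₁} a^{(2)}_{P₂} a^{(3)}_{P₃}| ≤ C · Π_{j=1}^{3} size_j((a^{(j)}_{P_j})_{P∈𝐏})^{θ_j} · energy_j((a^{(j)}_{P_j})_{P∈𝐏})^{1−θ_j}. -/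

import Mathlib

open MeasureTheory Set
open scoped ENNReal NNReal Classical

noncomputable section

/-- The `l`-th Walsh function. -/
def walsh : ℕ → ℝ → ℝ
  | 0, x => if 0 ≤ x ∧ x < 1 then 1 else 0
  | (n+1), x =>
    if (n+1) % 2 = 0 then walsh ((n+1)/2) (2*x) + walsh ((n+1)/2) (2*x - 1)
    else walsh ((n+1)/2) (2*x) - walsh ((n+1)/2) (2*x - 1)
  decreasing_by all_goals exact Nat.div_lt_self (Nat.succ_pos n) one_lt_two

/-- A tile `[2^{-k}n, 2^{-k}(n+1)) × [2^k l, 2^k(l+1))`. -/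
structure Tile where
  k : ℤ
  n : ℤ
  l : ℕ

namespace Tile

/-- The time interval `I_P`. -/
def spat (P : Tile) : Set ℝ := Ico ((2:ℝ)^(-P.k) * P.n) ((2:ℝ)^(-P.k) * (P.n + 1))

/-- The frequency interval `ω_P`. -/
def freq (P : Tile) : Set ℝ := Ico ((2:ℝ)^P.k * P.l) ((2:ℝ)^P.k * (P.l + 1))

/-- The tile as a subset of the phase plane. -/
def carrier (P : Tile) : Set (ℝ × ℝ) := P.spat ×ˢ P.freq

/-- The Walsh wave packet `φ_P`. -/
def wp (P : Tile) : ℝ → ℝ := fun x => (2:ℝ) ^ ((P.k : ℝ)/2) * walsh P.l ((2:ℝ)^P.k * x - P.n)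

/-- `P' < P` iff `I_{P'} ⊊ I_P` and `ω_P ⊆ ω_{P'}`. -/
def lt (P' P : Tile) : Prop := P'.spat ⊂ P.spat ∧ P.freq ⊆ P'.freq

/-- `P' ≤ P` iff `P' < P` or `P' = P`. -/
def le (P' P : Tile) : Prop := Tile.lt P' P ∨ P' = P

end Tile

/-- A quartile `[2^{-k}n, 2^{-k}(n+1)) × [2^{k+2} l, 2^{k+2}(l+1))`. -/
structure Quartile where
  k : ℤ
  n : ℤ
  l : ℕ

namespace Quartile

/-- The time interval `I_Q`. -/
def spat (Q : Quartile) : Set ℝ := Ico ((2:ℝ)^(-Q.k) * Q.n) ((2:ℝ)^(-Q.k) * (Q.n + 1))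

/-- The frequency interval `ω_Q`. -/
def freq (Q : Quartile) : Set ℝ := Ico ((2:ℝ)^(Q.k+2) * Q.l) ((2:ℝ)^(Q.k+2) * (Q.l + 1))

/-- The length `|I_Q| = 2^{-k}`. -/
def len (Q : Quartile) : ℝ := (2:ℝ)^(-Q.k)

/-- The sub-tiles `Q₁, Q₂, Q₃` (for `j = 1, 2, 3`). -/
def st (Q : Quartile) (j : ℕ) : Tile := ⟨Q.k, Q.n, 4 * Q.l + (j - 1)⟩

/-- The sub-bitile `Q₁₂ = Q₁ ∪ Q₂`, as a subset of the phase plane. -/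
def bicarrier (Q : Quartile) : Set (ℝ × ℝ) := Q.spat ×ˢ ((Q.st 1).freq ∪ (Q.st 2).freq)

/-- The order `<` on (sub-bi)tiles: `Q₁₂ < Q'₁₂`. -/
def biLt (Q Q' : Quartile) : Prop :=
  Q.spat ⊂ Q'.spat ∧ ((Q'.st 1).freq ∪ (Q'.st 2).freq) ⊆ ((Q.st 1).freq ∪ (Q.st 2).freq)

/-- The order `<` on quartiles. -/
def qlt (Q Q' : Quartile) : Prop := Q.spat ⊂ Q'.spat ∧ Q'.freq ⊆ Q.freq

end Quartile

/-- An `i`-tree `T` with top `Ptop`. -/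
def IsTree (i : ℕ) (Ptop : Quartile) (T : Finset Quartile) : Prop :=
  ∀ P ∈ T, Tile.le (P.st i) (Ptop.st i)

/-- The inner product `⟨f, φ_P⟩`. -/
def winner (f : ℝ → ℝ) (P : Tile) : ℝ := ∫ x, f x * P.wp x

/-- Indicator of a proposition. -/
def ind (p : Prop) : ℝ := if p then 1 else 0

/-- `size_j` of a sequence of numbers indexed by quartiles. -/
def size (PP : Finset Quartile) (j : ℕ) (a : Quartile → ℝ) : ℝ :=
  sSup {s | ∃ i ∈ ({1,2,3} : Set ℕ), i ≠ j ∧ ∃ Ptop : Quartile, ∃ T : Finset Quartile,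
    T ⊆ PP ∧ IsTree i Ptop T ∧
    s = Real.sqrt ((Ptop.len)⁻¹ * ∑ P ∈ T, |a P| ^ 2)}

/-- `energy_j` of a sequence of numbers indexed by quartiles. -/
def energy (PP : Finset Quartile) (j : ℕ) (a : Quartile → ℝ) : ℝ :=
  sSup {s | ∃ D : Finset Quartile, D ⊆ PP ∧
    (∀ P ∈ D, ∀ P' ∈ D, P ≠ P' → Disjoint ((P.st j).carrier) ((P'.st j).carrier)) ∧
    s = Real.sqrt (∑ P ∈ D, |a P| ^ 2)}


/-! ### Dyadic geometry -/

/-- The dyadic interval `[2^k m, 2^k (m+1))`. -/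
def dyadicIco (k m : ℤ) : Set ℝ := Ico ((2:ℝ)^k * m) ((2:ℝ)^k * (m + 1))

lemma dyadicIco_subset {k k' m m' : ℤ} (hk : k ≤ k') {x : ℝ}
    (hx : x ∈ dyadicIco k m) (hx' : x ∈ dyadicIco k' m') : dyadicIco k m ⊆ dyadicIco k' m' := by
  obtain ⟨d, rfl⟩ := Int.le.dest hk
  have h0 : (0:ℝ) < 2 ^ k := by positivity
  have e : (2:ℝ) ^ (k + d) = 2 ^ k * ((2 ^ d : ℤ) : ℝ) := by
    rw [zpow_add₀ two_ne_zero, zpow_natCast]; push_cast; rfl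
  simp only [dyadicIco, mem_Ico, e, mul_assoc] at hx hx' ⊢
  have a1 : (m:ℝ) < ((2 ^ d : ℤ) : ℝ) * (m' + 1) :=
    lt_of_mul_lt_mul_left (hx.1.trans_lt hx'.2) h0.le
  have a2 : ((2 ^ d : ℤ) : ℝ) * m' < m + 1 :=
    lt_of_mul_lt_mul_left (hx'.1.trans_lt hx.2) h0.le
  have b1 : m + 1 ≤ 2 ^ d * (m' + 1) := by exact_mod_cast a1
  have b2 : 2 ^ d * m' ≤ m := by
    have : 2 ^ d * m' < m + 1 := by exact_mod_cast a2
    omega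
  refine Ico_subset_Ico (mul_le_mul_of_nonneg_left ?_ h0.le) (mul_le_mul_of_nonneg_left ?_ h0.le)
  · exact_mod_cast b2
  · exact_mod_cast b1

lemma eq_of_mem_dyadicIco {k m m' : ℤ} {x : ℝ}
    (hx : x ∈ dyadicIco k m) (hx' : x ∈ dyadicIco k m') : m = m' := by
  have h0 : (0:ℝ) < 2 ^ k := by positivity
  have a1 : (m:ℝ) < m' + 1 := lt_of_mul_lt_mul_left (hx.1.trans_lt hx'.2) h0.le
  have a2 : (m':ℝ) < m + 1 := lt_of_mul_lt_mul_left (hx'.1.trans_lt hx.2) h0.le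
  have b1 : m < m' + 1 := by exact_mod_cast a1
  have b2 : m' < m + 1 := by exact_mod_cast a2
  omega

namespace Quartile

lemma len_pos (P : Quartile) : 0 < P.len := by unfold len; positivity

lemma spat_eq (P : Quartile) : P.spat = dyadicIco (-P.k) P.n := rfl

lemma freq_eq (P : Quartile) : P.freq = dyadicIco (P.k + 2) P.l := by
  simp [freq, dyadicIco]

lemma st_freq_eq (P : Quartile) (j : ℕ) :
    (P.st j).freq = dyadicIco P.k ((4 * P.l + (j - 1) : ℕ) : ℤ) := by
  simp only [Tile.freq, st, dyadicIco, Int.cast_natCast]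

lemma st_freq_subset (P : Quartile) {j : ℕ} (hj : j ∈ ({1, 2, 3} : Set ℕ)) :
    (P.st j).freq ⊆ P.freq := by
  have h0 : (0:ℝ) < 2 ^ P.k := by positivity
  have e : (2:ℝ) ^ (P.k + 2) = 2 ^ P.k * 4 := by
    rw [zpow_add₀ two_ne_zero]; norm_num
  simp only [Tile.freq, st, freq, e, mul_assoc]
  refine Ico_subset_Ico (mul_le_mul_of_nonneg_left ?_ h0.le) (mul_le_mul_of_nonneg_left ?_ h0.le) <;>
  · simp only [mem_insert_iff, mem_singleton_iff] at hj
    rcases hj with rfl | rfl | rfl <;> push_cast <;> linarith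

/-- The left endpoint of the frequency interval of the `j`-th sub-tile. -/
def stLeft (P : Quartile) (j : ℕ) : ℝ := (2:ℝ) ^ P.k * ((4 * P.l + (j - 1) : ℕ) : ℝ)

lemma stLeft_mem (P : Quartile) (j : ℕ) : P.stLeft j ∈ (P.st j).freq := by
  have h0 : (0:ℝ) < 2 ^ P.k := by positivity
  refine ⟨le_rfl, mul_lt_mul_of_pos_left ?_ h0⟩
  simp [st]

lemma lt_of_mem_st_freq (P : Quartile) {i j : ℕ} (hi : i ∈ ({1, 2, 3} : Set ℕ)) (h : i < j)
    {x y : ℝ} (hx : x ∈ (P.st i).freq) (hy : y ∈ (P.st j).freq) : x < y := by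
  have h0 : (0:ℝ) < 2 ^ P.k := by positivity
  refine hx.2.trans_le (le_trans (mul_le_mul_of_nonneg_left ?_ h0.le) hy.1)
  have : i ≠ 0 := by rintro rfl; simp at hi
  have : 4 * P.l + (i - 1) + 1 ≤ 4 * P.l + (j - 1) := by omega
  exact_mod_cast this

lemma len_le_iff {P Q : Quartile} : P.len ≤ Q.len ↔ Q.k ≤ P.k := by
  unfold len
  rw [zpow_le_zpow_iff_right₀ (by norm_num)]
  omega

lemma len_le_of_spat_subset {P Q : Quartile} (h : P.spat ⊆ Q.spat) : P.len ≤ Q.len := by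
  have hP := P.len_pos
  have : (2:ℝ) ^ (-P.k) * P.n < (2:ℝ) ^ (-P.k) * (P.n + 1) := by
    unfold len at hP; nlinarith
  obtain ⟨h1, h2⟩ := (Ico_subset_Ico_iff this).1 h
  unfold len
  linarith

lemma spat_subset_of_le {P Q : Quartile} {m : ℕ} (h : Tile.le (P.st m) (Q.st m)) :
    P.spat ⊆ Q.spat := by
  rcases h with h | h
  · exact h.1.subset
  · have : (P.st m).spat = (Q.st m).spat := by rw [h]
    exact this.subset

lemma st_freq_subset_of_le {P Q : Quartile} {m : ℕ} (h : Tile.le (P.st m) (Q.st m)) :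
    (Q.st m).freq ⊆ (P.st m).freq := by
  rcases h with h | h
  · exact h.2
  · rw [h]

lemma freq_subset_of_le {P Q : Quartile} {m : ℕ} (hm : m ∈ ({1, 2, 3} : Set ℕ))
    (h : Tile.le (P.st m) (Q.st m)) : Q.freq ⊆ P.freq := by
  have hk := len_le_iff.1 (len_le_of_spat_subset (spat_subset_of_le h))
  have hx := Q.stLeft_mem m
  have h1 := Q.st_freq_subset hm hx
  have h2 := P.st_freq_subset hm (st_freq_subset_of_le h hx)
  rw [freq_eq] at h1 h2 ⊢
  rw [freq_eq]
  exact dyadicIco_subset (by omega) h1 h2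

lemma le_of_subset {P P' Q : Quartile} {j : ℕ} (hj : j ∈ ({1, 2, 3} : Set ℕ))
    (hk : P.k < P'.k) (hs : P'.spat ⊆ P.spat) (hsQ : P.spat ⊆ Q.spat)
    (hf : P.freq ⊆ (P'.st j).freq) (hfQ : Q.freq ⊆ P.freq) :
    Tile.le (P'.st j) (Q.st j) := by
  refine Or.inl ⟨⟨hs.trans hsQ, fun h => ?_⟩, ((Q.st_freq_subset hj).trans hfQ).trans hf⟩
  have := len_le_iff.1 (len_le_of_spat_subset (hsQ.trans h))
  omega

lemma eq_of_overlap {P P' : Quartile} {j : ℕ} (hk : P.k = P'.k) {x : ℝ × ℝ}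
    (hx : x ∈ (P.st j).carrier) (hx' : x ∈ (P'.st j).carrier) : P = P' := by
  have h1 : P.n = P'.n := by
    refine eq_of_mem_dyadicIco (k := -P.k) hx.1 ?_
    rw [hk]; exact hx'.1
  have h2 : ((4 * P.l + (j - 1) : ℕ) : ℤ) = ((4 * P'.l + (j - 1) : ℕ) : ℤ) := by
    have a := hx.2
    have b := hx'.2
    rw [st_freq_eq] at a b
    rw [← hk] at b
    exact eq_of_mem_dyadicIco a b
  cases P; cases P'
  simp only [Quartile.mk.injEq] at *
  omega

lemma nested_of_overlap {P P' : Quartile} {j : ℕ} (hj : j ∈ ({1, 2, 3} : Set ℕ))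
    (hk : P'.k + 2 ≤ P.k) {x : ℝ × ℝ}
    (hx : x ∈ (P.st j).carrier) (hx' : x ∈ (P'.st j).carrier) :
    P.spat ⊆ P'.spat ∧ P'.freq ⊆ (P.st j).freq := by
  refine ⟨dyadicIco_subset (by omega) hx.1 hx'.1, ?_⟩
  have a := hx.2
  have b := P'.st_freq_subset hj hx'.2
  rw [st_freq_eq] at a ⊢
  rw [freq_eq] at b ⊢
  exact dyadicIco_subset hk b a

end Quartile

/-! ### Size and energy bounds as predicates -/

/-- `s` is an upper bound for `size_j`. -/
def SizeLe (PP : Finset Quartile) (j : ℕ) (a : Quartile → ℝ) (s : ℝ) : Prop :=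
  ∀ i ∈ ({1, 2, 3} : Set ℕ), i ≠ j → ∀ (Q : Quartile) (T : Finset Quartile), T ⊆ PP →
    IsTree i Q T → ∑ P ∈ T, |a P| ^ 2 ≤ s ^ 2 * Q.len

/-- `e` is an upper bound for `energy_j`. -/
def EnergyLe (PP : Finset Quartile) (j : ℕ) (a : Quartile → ℝ) (e : ℝ) : Prop :=
  ∀ D : Finset Quartile, D ⊆ PP →
    (∀ P ∈ D, ∀ P' ∈ D, P ≠ P' → Disjoint ((P.st j).carrier) ((P'.st j).carrier)) →
    ∑ P ∈ D, |a P| ^ 2 ≤ e ^ 2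

lemma SizeLe.mono {PP PP' : Finset Quartile} {j : ℕ} {a : Quartile → ℝ} {s : ℝ}
    (h : SizeLe PP j a s) (hs : PP' ⊆ PP) : SizeLe PP' j a s :=
  fun i hi hij Q T hT => h i hi hij Q T (hT.trans hs)

lemma EnergyLe.mono {PP PP' : Finset Quartile} {j : ℕ} {a : Quartile → ℝ} {e : ℝ}
    (h : EnergyLe PP j a e) (hs : PP' ⊆ PP) : EnergyLe PP' j a e :=
  fun D hD => h D (hD.trans hs)

lemma IsTree.len_le {i : ℕ} {Q : Quartile} {T : Finset Quartile} (h : IsTree i Q T)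
    {P : Quartile} (hP : P ∈ T) : P.len ≤ Q.len :=
  Quartile.len_le_of_spat_subset (Quartile.spat_subset_of_le (h P hP))

lemma isTree_singleton (i : ℕ) (P : Quartile) : IsTree i P {P} := by
  intro P' hP'
  rw [Finset.mem_singleton.1 hP']
  exact Or.inr rfl

lemma size_bddAbove (PP : Finset Quartile) (j : ℕ) (a : Quartile → ℝ) :
    BddAbove {s | ∃ i ∈ ({1,2,3} : Set ℕ), i ≠ j ∧ ∃ Ptop : Quartile, ∃ T : Finset Quartile,
      T ⊆ PP ∧ IsTree i Ptop T ∧ s = Real.sqrt ((Ptop.len)⁻¹ * ∑ P ∈ T, |a P| ^ 2)} := by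
  refine ⟨Real.sqrt (∑ P ∈ PP, P.len⁻¹ * |a P| ^ 2), ?_⟩
  rintro _ ⟨i, -, -, Q, T, hT, htree, rfl⟩
  refine Real.sqrt_le_sqrt ?_
  rw [Finset.mul_sum]
  refine (Finset.sum_le_sum fun P hP => ?_).trans
    (Finset.sum_le_sum_of_subset_of_nonneg hT fun P _ _ => ?_)
  · exact mul_le_mul_of_nonneg_right (inv_anti₀ P.len_pos (htree.len_le hP)) (by positivity)
  · have := P.len_pos
    positivity

lemma sizeLe_size (PP : Finset Quartile) (j : ℕ) (a : Quartile → ℝ) :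
    SizeLe PP j a (size PP j a) := by
  intro i hi hij Q T hT htree
  have h : Real.sqrt ((Q.len)⁻¹ * ∑ P ∈ T, |a P| ^ 2) ≤ size PP j a :=
    le_csSup (size_bddAbove PP j a) ⟨i, hi, hij, Q, T, hT, htree, rfl⟩
  have h2 := (Real.sqrt_le_left (le_trans (Real.sqrt_nonneg _) h)).1 h
  rwa [inv_mul_le_iff₀ Q.len_pos, mul_comm] at h2

lemma size_nonneg (PP : Finset Quartile) (j : ℕ) (a : Quartile → ℝ) : 0 ≤ size PP j a := by
  refine Real.sSup_nonneg ?_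
  rintro _ ⟨i, -, -, Q, T, -, -, rfl⟩
  exact Real.sqrt_nonneg _

lemma energyLe_energy (PP : Finset Quartile) (j : ℕ) (a : Quartile → ℝ) :
    EnergyLe PP j a (energy PP j a) := by
  intro D hD hdisj
  have hb : BddAbove {s | ∃ D : Finset Quartile, D ⊆ PP ∧
      (∀ P ∈ D, ∀ P' ∈ D, P ≠ P' → Disjoint ((P.st j).carrier) ((P'.st j).carrier)) ∧
      s = Real.sqrt (∑ P ∈ D, |a P| ^ 2)} := by
    refine ⟨Real.sqrt (∑ P ∈ PP, |a P| ^ 2), ?_⟩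
    rintro _ ⟨D, hD, -, rfl⟩
    exact Real.sqrt_le_sqrt
      (Finset.sum_le_sum_of_subset_of_nonneg hD fun P _ _ => by positivity)
  have h : Real.sqrt (∑ P ∈ D, |a P| ^ 2) ≤ energy PP j a :=
    le_csSup hb ⟨D, hD, hdisj, rfl⟩
  exact (Real.sqrt_le_left (le_trans (Real.sqrt_nonneg _) h)).1 h

lemma energy_nonneg (PP : Finset Quartile) (j : ℕ) (a : Quartile → ℝ) : 0 ≤ energy PP j a := by
  refine Real.sSup_nonneg ?_
  rintro _ ⟨D, -, -, rfl⟩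
  exact Real.sqrt_nonneg _

lemma SizeLe.abs_le {PP : Finset Quartile} {i j : ℕ} {a : Quartile → ℝ} {s : ℝ}
    (h : SizeLe PP j a s) (hs : 0 ≤ s) (hi : i ∈ ({1, 2, 3} : Set ℕ)) (hij : i ≠ j)
    {P : Quartile} (hP : P ∈ PP) : |a P| ≤ Real.sqrt P.len * s := by
  have h1 := h i hi hij P {P} (by simpa using hP) (isTree_singleton i P)
  rw [Finset.sum_singleton] at h1
  refine abs_le_of_sq_le_sq' ?_ (by positivity) |>.2
  rw [mul_pow, Real.sq_sqrt P.len_pos.le]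
  linarith

lemma EnergyLe.abs_le {PP : Finset Quartile} {j : ℕ} {a : Quartile → ℝ} {e : ℝ}
    (h : EnergyLe PP j a e) (he : 0 ≤ e) {P : Quartile} (hP : P ∈ PP) : |a P| ≤ e := by
  have h1 := h {P} (by simpa using hP) (by
    intro P₁ h₁ P₂ h₂ hne
    rw [Finset.mem_singleton] at h₁ h₂
    exact absurd (h₁.trans h₂.symm) hne)
  rw [Finset.sum_singleton] at h1
  exact abs_le_of_sq_le_sq' h1 he |>.2

/-! ### The single tree estimate -/

lemma tree_estimate_aux {PP T : Finset Quartile} {i j k : ℕ} {x y z : Quartile → ℝ}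
    {u v w : ℝ} (hi : i ∈ ({1, 2, 3} : Set ℕ)) (hj : j ∈ ({1, 2, 3} : Set ℕ))
    (hij : i ≠ j) (hik : i ≠ k) (hu : 0 ≤ u) (hv : 0 ≤ v) (hw : 0 ≤ w)
    (hx : SizeLe PP i x u) (hy : SizeLe PP j y v) (hz : SizeLe PP k z w)
    {Q : Quartile} (hT : T ⊆ PP) (htree : IsTree i Q T) :
    ∑ P ∈ T, (Real.sqrt P.len)⁻¹ * (|x P| * (|y P| * |z P|)) ≤ u * (v * w) * Q.len := by
  have h1 : ∀ P ∈ T, (Real.sqrt P.len)⁻¹ * (|x P| * (|y P| * |z P|)) ≤ u * (|y P| * |z P|) := by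
    intro P hP
    have := hx.abs_le hu hj hij.symm (hT hP)
    have hl : 0 < Real.sqrt P.len := Real.sqrt_pos.2 P.len_pos
    rw [← mul_assoc]
    refine mul_le_mul_of_nonneg_right ?_ (by positivity)
    rwa [inv_mul_le_iff₀ hl]
  refine (Finset.sum_le_sum h1).trans ?_
  rw [← Finset.mul_sum, mul_assoc]
  refine mul_le_mul_of_nonneg_left ?_ hu
  have hl := Q.len_pos
  refine (abs_le_of_sq_le_sq' ?_ (by positivity)).2
  refine (Finset.sum_mul_sq_le_sq_mul_sq T _ _).trans ?_
  calc _ ≤ (v ^ 2 * Q.len) * (w ^ 2 * Q.len) :=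
        mul_le_mul (hy i hi hij Q T hT htree) (hz i hi hik Q T hT htree)
          (by positivity) (by positivity)
    _ = _ := by ring

lemma tree_estimate {PP T : Finset Quartile} {x y z : Quartile → ℝ}
    {u v w : ℝ} (hu : 0 ≤ u) (hv : 0 ≤ v) (hw : 0 ≤ w)
    (hx : SizeLe PP 1 x u) (hy : SizeLe PP 2 y v) (hz : SizeLe PP 3 z w)
    {m : ℕ} (hm : m ∈ ({1, 2, 3} : Set ℕ)) {Q : Quartile} (hT : T ⊆ PP) (htree : IsTree m Q T) :
    ∑ P ∈ T, (Real.sqrt P.len)⁻¹ * (|x P| * (|y P| * |z P|)) ≤ u * (v * w) * Q.len := by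
  simp only [mem_insert_iff, mem_singleton_iff] at hm
  rcases hm with rfl | rfl | rfl
  · exact tree_estimate_aux (by simp) (j := 2) (by simp) (by simp) (by simp) hu hv hw hx hy hz
      hT htree
  · calc _ = ∑ P ∈ T, (Real.sqrt P.len)⁻¹ * (|y P| * (|x P| * |z P|)) :=
          Finset.sum_congr rfl fun P _ => by ring
      _ ≤ v * (u * w) * Q.len :=
          tree_estimate_aux (by simp) (j := 1) (by simp) (by simp) (by simp) hv hu hw hy hx hz
            hT htree
      _ = _ := by ring
  · calc _ = ∑ P ∈ T, (Real.sqrt P.len)⁻¹ * (|z P| * (|x P| * |y P|)) :=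
          Finset.sum_congr rfl fun P _ => by ring
      _ ≤ w * (u * v) * Q.len :=
          tree_estimate_aux (by simp) (j := 1) (by simp) (by simp) (by simp) hw hu hv hz hx hy
            hT htree
      _ = _ := by ring

/-! ### Tree selection -/

/-- Tiles `P_j` from two `i`-trees are disjoint, if the second tree was selected after the first. -/
lemma disjoint_of_selected {i j : ℕ} (hi : i ∈ ({1, 2, 3} : Set ℕ))
    (hj : j ∈ ({1, 2, 3} : Set ℕ)) {σ : ℝ}
    (hσ : ∀ (P : Quartile) (x y : ℝ), x ∈ (P.st i).freq → y ∈ (P.st j).freq → σ * x < σ * y)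
    {P P' Q Q' : Quartile} (hpar : P.k % 2 = P'.k % 2) (hne : P ≠ P')
    (hP : Tile.le (P.st i) (Q.st i)) (hP' : Tile.le (P'.st i) (Q'.st i))
    (hQ : σ * Q'.stLeft i ≤ σ * Q.stLeft i) (hrem : ¬ Tile.le (P'.st j) (Q.st j)) :
    Disjoint ((P.st j).carrier) ((P'.st j).carrier) := by
  rw [Set.disjoint_left]
  intro x hx hx'
  rcases lt_trichotomy P.k P'.k with hk | hk | hk
  · obtain ⟨h1, h2⟩ := Quartile.nested_of_overlap hj (by omega) hx' hx
    exact hrem (Quartile.le_of_subset hj hk h1 (Quartile.spat_subset_of_le hP) h2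
      (Quartile.freq_subset_of_le hi hP))
  · exact hne (Quartile.eq_of_overlap hk hx hx')
  · obtain ⟨-, h2⟩ := Quartile.nested_of_overlap hj (by omega) hx hx'
    have := hσ P _ _ (Quartile.st_freq_subset_of_le hP (Q.stLeft_mem i))
      (h2 (P'.st_freq_subset hi (Quartile.st_freq_subset_of_le hP' (Q'.stLeft_mem i))))
    linarith

/-- Tiles `P_j` in a single `i`-tree are disjoint. -/
lemma disjoint_of_isTree {i j : ℕ} (hi : i ∈ ({1, 2, 3} : Set ℕ))
    (hj : j ∈ ({1, 2, 3} : Set ℕ)) (hij : i ≠ j) {P P' Q : Quartile}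
    (hpar : P.k % 2 = P'.k % 2) (hne : P ≠ P')
    (hP : Tile.le (P.st i) (Q.st i)) (hP' : Tile.le (P'.st i) (Q.st i)) :
    Disjoint ((P.st j).carrier) ((P'.st j).carrier) := by
  have key : ∀ R R' : Quartile, Tile.le (R.st i) (Q.st i) → Tile.le (R'.st i) (Q.st i) →
      R'.freq ⊆ (R.st j).freq → False := by
    intro R R' hR hR' hsub
    have h1 := Quartile.st_freq_subset_of_le hR (Q.stLeft_mem i)
    have h2 := hsub (R'.st_freq_subset hi (Quartile.st_freq_subset_of_le hR' (Q.stLeft_mem i)))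
    rcases hij.lt_or_gt with h | h
    · exact lt_irrefl _ (R.lt_of_mem_st_freq hi h h1 h2)
    · exact lt_irrefl _ (R.lt_of_mem_st_freq hj h h2 h1)
  rw [Set.disjoint_left]
  intro x hx hx'
  rcases lt_trichotomy P.k P'.k with hk | hk | hk
  · exact key P' P hP' hP (Quartile.nested_of_overlap hj (by omega) hx' hx).2
  · exact hne (Quartile.eq_of_overlap hk hx hx')
  · exact key P P' hP hP' (Quartile.nested_of_overlap hj (by omega) hx hx').2

lemma exists_selection_aux {i j : ℕ} (hi : i ∈ ({1, 2, 3} : Set ℕ))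
    (hj : j ∈ ({1, 2, 3} : Set ℕ)) (hij : i ≠ j) {σ : ℝ}
    (hσ : ∀ (P : Quartile) (x y : ℝ), x ∈ (P.st i).freq → y ∈ (P.st j).freq → σ * x < σ * y)
    {a g : Quartile → ℝ} {lam W : ℝ} (hg0 : ∀ P, 0 ≤ g P) (hW : 0 ≤ W)
    (top : Finset Quartile → Quartile) (good : Finset Quartile → Prop)
    (hgood : ∀ S, good S → IsTree i (top S) S ∧ lam ^ 2 * (top S).len < ∑ P ∈ S, |a P| ^ 2)
    (PP : Finset Quartile) :
    (∀ P ∈ PP, ∀ P' ∈ PP, P.k % 2 = P'.k % 2) →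
    (∀ m ∈ ({1, 2, 3} : Set ℕ), ∀ (Q : Quartile) (T : Finset Quartile), T ⊆ PP →
      IsTree m Q T → ∑ P ∈ T, g P ≤ W * Q.len) →
    ∃ PP' ⊆ PP, ∃ D ⊆ PP,
      (∀ P ∈ D, ∀ P' ∈ D, P ≠ P' → Disjoint ((P.st j).carrier) ((P'.st j).carrier)) ∧
      (∑ P ∈ PP, g P - ∑ P ∈ PP', g P) * lam ^ 2 ≤ 2 * W * ∑ P ∈ D, |a P| ^ 2 ∧
      (∀ S ⊆ PP', ¬ good S) ∧ (∀ P ∈ D, ∃ S ⊆ PP, P ∈ S ∧ good S) := by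
  induction PP using Finset.strongInduction with
  | H PP ih =>
  intro hpar hg
  by_cases hne : (PP.powerset.filter good).Nonempty
  swap
  · refine ⟨PP, subset_rfl, ∅, by simp, by simp, by simp, ?_, by simp⟩
    intro S hS hSg
    exact hne ⟨S, by simp [hS, hSg]⟩
  obtain ⟨S, hS, hmax⟩ := Finset.exists_max_image (PP.powerset.filter good)
    (fun S => σ * (top S).stLeft i) hne
  rw [Finset.mem_filter, Finset.mem_powerset] at hS
  obtain ⟨hSP, hSg⟩ := hS
  obtain ⟨hStree, hSmass⟩ := hgood S hSg
  set Q := top S with hQ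
  set A := PP.filter (fun P => Tile.le (P.st i) (Q.st i)) with hA
  set B := PP.filter (fun P => Tile.le (P.st j) (Q.st j)) with hB
  set R := PP \ (A ∪ B) with hR
  have hRP : R ⊆ PP := Finset.sdiff_subset
  have hSA : S ⊆ A := fun P hP => Finset.mem_filter.2 ⟨hSP hP, hStree P hP⟩
  have hSne : S.Nonempty := by
    rw [Finset.nonempty_iff_ne_empty]
    rintro h
    rw [h, Finset.sum_empty] at hSmass
    have := Q.len_pos
    nlinarith [sq_nonneg lam, mul_nonneg (sq_nonneg lam) this.le]
  have hRlt : R ⊂ PP := by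
    obtain ⟨P, hP⟩ := hSne
    refine Finset.ssubset_iff_subset_ne.2 ⟨hRP, fun h => ?_⟩
    have : P ∈ R := by rw [h]; exact hSP hP
    rw [hR, Finset.mem_sdiff] at this
    exact this.2 (Finset.mem_union_left _ (hSA hP))
  obtain ⟨PP', hPP', D, hDR, hdisj, hmass, hno, hDgood⟩ := ih R hRlt
    (fun P hP P' hP' => hpar P (hRP hP) P' (hRP hP'))
    (fun m hm Q T hT => hg m hm Q T (hT.trans hRP))
  have hSD : Disjoint S D := by
    rw [Finset.disjoint_left]
    intro P hP hPD
    have := hDR hPD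
    rw [hR, Finset.mem_sdiff] at this
    exact this.2 (Finset.mem_union_left _ (hSA hP))
  have cross : ∀ P ∈ S, ∀ P' ∈ D, Disjoint ((P.st j).carrier) ((P'.st j).carrier) := by
    intro P hP P' hP'
    obtain ⟨S', hS'R, hPS', hS'g⟩ := hDgood P' hP'
    have hP'R := hDR hP'
    refine disjoint_of_selected hi hj hσ (hpar P (hSP hP) P' (hRP hP'R))
      (fun h => Finset.disjoint_left.1 hSD hP (h ▸ hP')) (hStree P hP)
      ((hgood S' hS'g).1 P' hPS') (hmax S' ?_) ?_
    · simp [hS'R.trans hRP, hS'g]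
    · intro h
      rw [hR, Finset.mem_sdiff] at hP'R
      exact hP'R.2 (Finset.mem_union_right _ (Finset.mem_filter.2 ⟨hP'R.1, h⟩))
  refine ⟨PP', hPP'.trans hRP, S ∪ D, Finset.union_subset hSP (hDR.trans hRP), ?_, ?_, hno, ?_⟩
  · intro P hP P' hP' hne
    rcases Finset.mem_union.1 hP with h | h <;> rcases Finset.mem_union.1 hP' with h' | h'
    · exact disjoint_of_isTree hi hj hij (hpar P (hSP h) P' (hSP h')) hne (hStree P h)
        (hStree P' h')
    · exact cross P h P' h'
    · exact (cross P' h' P h).symm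
    · exact hdisj P h P' h' hne
  · rw [Finset.sum_union hSD]
    have e1 : ∑ P ∈ PP, g P = ∑ P ∈ R, g P + ∑ P ∈ A ∪ B, g P :=
      (Finset.sum_sdiff (Finset.union_subset (Finset.filter_subset _ _)
        (Finset.filter_subset _ _))).symm
    have e2 : ∑ P ∈ A ∪ B, g P ≤ ∑ P ∈ A, g P + ∑ P ∈ B, g P := by
      rw [← Finset.sum_union_inter]
      exact le_add_of_nonneg_right (Finset.sum_nonneg fun P _ => hg0 P)
    have e3 := hg i hi Q A (Finset.filter_subset _ _) fun P hP => (Finset.mem_filter.1 hP).2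
    have e4 := hg j hj Q B (Finset.filter_subset _ _) fun P hP => (Finset.mem_filter.1 hP).2
    have e5 : W * (lam ^ 2 * Q.len) ≤ W * ∑ P ∈ S, |a P| ^ 2 :=
      mul_le_mul_of_nonneg_left hSmass.le hW
    have e6 : (∑ P ∈ A ∪ B, g P) * lam ^ 2 ≤ (2 * W * Q.len) * lam ^ 2 :=
      mul_le_mul_of_nonneg_right (by linarith) (sq_nonneg _)
    rw [e1]
    linarith
  · intro P hP
    rcases Finset.mem_union.1 hP with h | h
    · exact ⟨S, hSP, h, hSg⟩
    · obtain ⟨S', h1, h2, h3⟩ := hDgood P h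
      exact ⟨S', h1.trans hRP, h2, h3⟩

/-- Removal of the heavy `i`-trees for `a`. -/
lemma exists_selection {i j : ℕ} (hi : i ∈ ({1, 2, 3} : Set ℕ))
    (hj : j ∈ ({1, 2, 3} : Set ℕ)) (hij : i ≠ j)
    {a g : Quartile → ℝ} {lam W e : ℝ} (hg0 : ∀ P, 0 ≤ g P) (hW : 0 ≤ W)
    {PP : Finset Quartile} (hpar : ∀ P ∈ PP, ∀ P' ∈ PP, P.k % 2 = P'.k % 2)
    (hg : ∀ m ∈ ({1, 2, 3} : Set ℕ), ∀ (Q : Quartile) (T : Finset Quartile), T ⊆ PP →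
      IsTree m Q T → ∑ P ∈ T, g P ≤ W * Q.len)
    (he : EnergyLe PP j a e) :
    ∃ PP' ⊆ PP, (∑ P ∈ PP, g P - ∑ P ∈ PP', g P) * lam ^ 2 ≤ 2 * W * e ^ 2 ∧
      ∀ (Q : Quartile) (T : Finset Quartile), T ⊆ PP' → IsTree i Q T →
        ∑ P ∈ T, |a P| ^ 2 ≤ lam ^ 2 * Q.len := by
  obtain ⟨σ, hσ⟩ : ∃ σ : ℝ, ∀ (P : Quartile) (x y : ℝ), x ∈ (P.st i).freq →
      y ∈ (P.st j).freq → σ * x < σ * y := by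
    rcases hij.lt_or_gt with h | h
    · refine ⟨1, fun P x y hx hy => ?_⟩
      linarith [P.lt_of_mem_st_freq hi h hx hy]
    · refine ⟨-1, fun P x y hx hy => ?_⟩
      linarith [P.lt_of_mem_st_freq hj h hy hx]
  have htop : ∀ S : Finset Quartile, ∃ Q : Quartile,
      (∃ Q', IsTree i Q' S ∧ lam ^ 2 * Q'.len < ∑ P ∈ S, |a P| ^ 2) →
      IsTree i Q S ∧ lam ^ 2 * Q.len < ∑ P ∈ S, |a P| ^ 2 := by
    intro S
    by_cases h : ∃ Q', IsTree i Q' S ∧ lam ^ 2 * Q'.len < ∑ P ∈ S, |a P| ^ 2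
    · exact ⟨h.choose, fun _ => h.choose_spec⟩
    · exact ⟨⟨0, 0, 0⟩, fun h' => absurd h' h⟩
  choose top htop using htop
  obtain ⟨PP', hsub, D, hD, hdisj, hmass, hno, -⟩ := exists_selection_aux hi hj hij hσ hg0 hW top
    (fun S => ∃ Q', IsTree i Q' S ∧ lam ^ 2 * Q'.len < ∑ P ∈ S, |a P| ^ 2) htop PP hpar hg
  refine ⟨PP', hsub, hmass.trans ?_, ?_⟩
  · exact mul_le_mul_of_nonneg_left (he D hD hdisj) (by positivity)
  · intro Q T hT htree
    by_contra! h
    exact hno T hT ⟨Q, htree, h⟩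

/-- The size decomposition for a single index `j`. -/
lemma exists_size_decomposition {j : ℕ} (hj : j ∈ ({1, 2, 3} : Set ℕ))
    {a g : Quartile → ℝ} {lam W e : ℝ} (hg0 : ∀ P, 0 ≤ g P) (hW : 0 ≤ W)
    {PP : Finset Quartile} (hpar : ∀ P ∈ PP, ∀ P' ∈ PP, P.k % 2 = P'.k % 2)
    (hg : ∀ m ∈ ({1, 2, 3} : Set ℕ), ∀ (Q : Quartile) (T : Finset Quartile), T ⊆ PP →
      IsTree m Q T → ∑ P ∈ T, g P ≤ W * Q.len)
    (he : EnergyLe PP j a e) :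
    ∃ PP' ⊆ PP, (∑ P ∈ PP, g P - ∑ P ∈ PP', g P) * lam ^ 2 ≤ 4 * W * e ^ 2 ∧
      SizeLe PP' j a lam := by
  obtain ⟨i, i', hi, hi', hij, hij', hex⟩ : ∃ i i' : ℕ, i ∈ ({1, 2, 3} : Set ℕ) ∧
      i' ∈ ({1, 2, 3} : Set ℕ) ∧ i ≠ j ∧ i' ≠ j ∧
      ∀ m ∈ ({1, 2, 3} : Set ℕ), m ≠ j → m = i ∨ m = i' := by
    simp only [mem_insert_iff, mem_singleton_iff] at hj ⊢
    rcases hj with rfl | rfl | rfl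
    · exact ⟨2, 3, by omega, by omega, by omega, by omega, fun m _ _ => by omega⟩
    · exact ⟨1, 3, by omega, by omega, by omega, by omega, fun m _ _ => by omega⟩
    · exact ⟨1, 2, by omega, by omega, by omega, by omega, fun m _ _ => by omega⟩
  obtain ⟨P₁, hs₁, hm₁, hn₁⟩ := exists_selection (lam := lam) hi hj hij hg0 hW hpar hg he
  obtain ⟨P₂, hs₂, hm₂, hn₂⟩ := exists_selection (lam := lam) hi' hj hij' hg0 hW
    (fun P hP P' hP' => hpar P (hs₁ hP) P' (hs₁ hP'))
    (fun m hm Q T hT => hg m hm Q T (hT.trans hs₁)) (he.mono hs₁)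
  refine ⟨P₂, hs₂.trans hs₁, by linarith, ?_⟩
  intro m hm hmj Q T hT htree
  rcases hex m hm hmj with rfl | rfl
  · exact hn₁ Q T (hT.trans hs₂) htree
  · exact hn₂ Q T hT htree

/-! ### The trilinear form -/

/-- The absolute value of the summand of the trilinear form. -/
def trilinearTerm (x y z : Quartile → ℝ) (P : Quartile) : ℝ :=
  (Real.sqrt P.len)⁻¹ * (|x P| * (|y P| * |z P|))

lemma trilinearTerm_nonneg (x y z : Quartile → ℝ) (P : Quartile) :
    0 ≤ trilinearTerm x y z P := by
  unfold trilinearTerm; positivity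

lemma SizeLe.min {PP : Finset Quartile} {j : ℕ} {a : Quartile → ℝ} {s t : ℝ}
    (hs : SizeLe PP j a s) (ht : SizeLe PP j a t) : SizeLe PP j a (min s t) := by
  rcases min_choice s t with h | h <;> rw [h] <;> assumption

/-- The contribution of one size level. -/
lemma exists_level_decomposition {PP : Finset Quartile} {x y z : Quartile → ℝ}
    {S₁ S₂ S₃ E₁ E₂ E₃ δ : ℝ}
    (hpar : ∀ P ∈ PP, ∀ P' ∈ PP, P.k % 2 = P'.k % 2)
    (hS₁ : 0 < S₁) (hS₂ : 0 < S₂) (hS₃ : 0 < S₃) (hE₁ : 0 < E₁) (hE₂ : 0 < E₂) (hE₃ : 0 < E₃)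
    (hδ : 0 < δ)
    (s₁ : SizeLe PP 1 x S₁) (s₂ : SizeLe PP 2 y S₂) (s₃ : SizeLe PP 3 z S₃)
    (e₁ : EnergyLe PP 1 x E₁) (e₂ : EnergyLe PP 2 y E₂) (e₃ : EnergyLe PP 3 z E₃)
    (t₁ : SizeLe PP 1 x (δ * E₁)) (t₂ : SizeLe PP 2 y (δ * E₂)) (t₃ : SizeLe PP 3 z (δ * E₃)) :
    ∃ PP' ⊆ PP, SizeLe PP' 1 x (δ / 2 * E₁) ∧ SizeLe PP' 2 y (δ / 2 * E₂) ∧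
      SizeLe PP' 3 z (δ / 2 * E₃) ∧
      ∑ P ∈ PP, trilinearTerm x y z P ≤ ∑ P ∈ PP', trilinearTerm x y z P +
        48 * (δ ^ 2)⁻¹ * (min (δ * E₁) S₁ * (min (δ * E₂) S₂ * min (δ * E₃) S₃)) := by
  have m₁ : 0 < min (δ * E₁) S₁ := lt_min (by positivity) hS₁
  have m₂ : 0 < min (δ * E₂) S₂ := lt_min (by positivity) hS₂
  have m₃ : 0 < min (δ * E₃) S₃ := lt_min (by positivity) hS₃
  set W := min (δ * E₁) S₁ * (min (δ * E₂) S₂ * min (δ * E₃) S₃) with hWdef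
  have hW : 0 ≤ W := by positivity
  have hg : ∀ m ∈ ({1, 2, 3} : Set ℕ), ∀ (Q : Quartile) (T : Finset Quartile), T ⊆ PP →
      IsTree m Q T → ∑ P ∈ T, trilinearTerm x y z P ≤ W * Q.len := fun m hm Q T hT htree =>
    tree_estimate m₁.le m₂.le m₃.le (t₁.min s₁) (t₂.min s₂) (t₃.min s₃) hm hT htree
  have hg0 := trilinearTerm_nonneg x y z
  have norm : ∀ {A e : ℝ}, 0 < e → A * (δ / 2 * e) ^ 2 ≤ 4 * W * e ^ 2 →
      A ≤ 16 * (δ ^ 2)⁻¹ * W := by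
    intro A e he h
    have h2 : A * (δ ^ 2) ≤ 16 * W := by
      have : 0 < e ^ 2 := by positivity
      refine le_of_mul_le_mul_right ?_ this
      linarith
    rw [mul_assoc, mul_comm _ W, ← mul_assoc, ← div_eq_mul_inv, le_div_iff₀ (by positivity)]
    exact h2
  obtain ⟨P₁, hs₁, hm₁, hn₁⟩ := exists_size_decomposition (j := 1) (lam := δ / 2 * E₁)
    (by simp) hg0 hW hpar hg e₁
  obtain ⟨P₂, hs₂, hm₂, hn₂⟩ := exists_size_decomposition (j := 2) (lam := δ / 2 * E₂)
    (by simp) hg0 hW (fun P hP P' hP' => hpar P (hs₁ hP) P' (hs₁ hP'))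
    (fun m hm Q T hT => hg m hm Q T (hT.trans hs₁)) (e₂.mono hs₁)
  obtain ⟨P₃, hs₃, hm₃, hn₃⟩ := exists_size_decomposition (j := 3) (lam := δ / 2 * E₃)
    (by simp) hg0 hW (fun P hP P' hP' => hpar P (hs₁ (hs₂ hP)) P' (hs₁ (hs₂ hP')))
    (fun m hm Q T hT => hg m hm Q T (hT.trans (hs₂.trans hs₁))) (e₃.mono (hs₂.trans hs₁))
  refine ⟨P₃, hs₃.trans (hs₂.trans hs₁), hn₁.mono (hs₃.trans hs₂), hn₂.mono hs₃, hn₃, ?_⟩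
  have k₁ := norm hE₁ hm₁
  have k₂ := norm hE₂ hm₂
  have k₃ := norm hE₃ hm₃
  linarith

/-- The contribution of finitely many size levels, and a remainder. -/
lemma trilinear_le_sum_levels {x y z : Quartile → ℝ}
    {S₁ S₂ S₃ E₁ E₂ E₃ : ℝ}
    (hS₁ : 0 < S₁) (hS₂ : 0 < S₂) (hS₃ : 0 < S₃) (hE₁ : 0 < E₁) (hE₂ : 0 < E₂) (hE₃ : 0 < E₃)
    (M : ℕ) : ∀ (δ : ℝ) (PP : Finset Quartile), 0 < δ →
    (∀ P ∈ PP, ∀ P' ∈ PP, P.k % 2 = P'.k % 2) →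
    SizeLe PP 1 x S₁ → SizeLe PP 2 y S₂ → SizeLe PP 3 z S₃ →
    EnergyLe PP 1 x E₁ → EnergyLe PP 2 y E₂ → EnergyLe PP 3 z E₃ →
    SizeLe PP 1 x (δ * E₁) → SizeLe PP 2 y (δ * E₂) → SizeLe PP 3 z (δ * E₃) →
    ∑ P ∈ PP, trilinearTerm x y z P ≤
      ∑ t ∈ Finset.range M, 48 * ((δ / 2 ^ t) ^ 2)⁻¹ *
        (min (δ / 2 ^ t * E₁) S₁ * (min (δ / 2 ^ t * E₂) S₂ * min (δ / 2 ^ t * E₃) S₃)) +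
      (δ / 2 ^ M * E₁) * ((δ / 2 ^ M * E₂) * (δ / 2 ^ M * E₃)) * ∑ P ∈ PP, P.len := by
  induction M with
  | zero =>
    intro δ PP hδ _ _ _ _ _ _ _ t₁ t₂ t₃
    simp only [Finset.range_zero, Finset.sum_empty, zero_add, pow_zero, div_one]
    rw [Finset.mul_sum]
    refine Finset.sum_le_sum fun P hP => ?_
    have := tree_estimate (T := {P}) (m := 1) (Q := P) (by positivity) (by positivity)
      (by positivity) t₁ t₂ t₃ (by simp) (by simpa using hP) (isTree_singleton 1 P)
    rwa [Finset.sum_singleton] at this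
  | succ M ih =>
    intro δ PP hδ hpar s₁ s₂ s₃ e₁ e₂ e₃ t₁ t₂ t₃
    obtain ⟨PP', hsub, u₁, u₂, u₃, hle⟩ := exists_level_decomposition hpar hS₁ hS₂ hS₃ hE₁ hE₂ hE₃
      hδ s₁ s₂ s₃ e₁ e₂ e₃ t₁ t₂ t₃
    have h := ih (δ / 2) PP' (by positivity)
      (fun P hP P' hP' => hpar P (hsub hP) P' (hsub hP'))
      (s₁.mono hsub) (s₂.mono hsub) (s₃.mono hsub) (e₁.mono hsub) (e₂.mono hsub) (e₃.mono hsub)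
      u₁ u₂ u₃
    have hd : ∀ t : ℕ, δ / 2 / 2 ^ t = δ / 2 ^ (t + 1) := fun t => by
      rw [pow_succ, div_div, mul_comm]
    simp only [hd] at h
    rw [Finset.sum_range_succ', pow_zero, div_one]
    have hlen : ∑ P ∈ PP', P.len ≤ ∑ P ∈ PP, P.len :=
      Finset.sum_le_sum_of_subset_of_nonneg hsub fun P _ _ => P.len_pos.le
    have := mul_le_mul_of_nonneg_left hlen (show (0:ℝ) ≤ (δ / 2 ^ (M + 1) * E₁) *
      ((δ / 2 ^ (M + 1) * E₂) * (δ / 2 ^ (M + 1) * E₃)) by positivity)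
    linarith

/-! ### Summation over the size levels -/

lemma min_le_rpow_mul_rpow {u v α : ℝ} (hu : 0 < u) (hv : 0 < v) (h0 : 0 ≤ α) (h1 : α ≤ 1) :
    min u v ≤ u ^ (1 - α) * v ^ α := by
  have hm : 0 < min u v := lt_min hu hv
  calc min u v = min u v ^ (1 - α) * min u v ^ α := by
        rw [← Real.rpow_add hm]; simp
    _ ≤ _ := by
        refine mul_le_mul (Real.rpow_le_rpow hm.le (min_le_left _ _) (by linarith))
          (Real.rpow_le_rpow hm.le (min_le_right _ _) h0) (by positivity) (by positivity)

/-- The geometric mean `∏ (S_j / E_j) ^ θ_j` controls one level up to a power of `δ`. -/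
lemma level_le {S₁ S₂ S₃ E₁ E₂ E₃ δ θ₁ θ₂ θ₃ c : ℝ}
    (hS₁ : 0 < S₁) (hS₂ : 0 < S₂) (hS₃ : 0 < S₃) (hE₁ : 0 < E₁) (hE₂ : 0 < E₂) (hE₃ : 0 < E₃)
    (hδ : 0 < δ) (hsum : θ₁ + θ₂ + θ₃ = 1)
    (h₁ : 0 ≤ (1 + c) * θ₁) (h₁' : (1 + c) * θ₁ ≤ 1)
    (h₂ : 0 ≤ (1 + c) * θ₂) (h₂' : (1 + c) * θ₂ ≤ 1)
    (h₃ : 0 ≤ (1 + c) * θ₃) (h₃' : (1 + c) * θ₃ ≤ 1) :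
    (δ ^ 2)⁻¹ * (min (δ * E₁) S₁ * (min (δ * E₂) S₂ * min (δ * E₃) S₃)) ≤
      (S₁ ^ θ₁ * E₁ ^ (1 - θ₁)) * ((S₂ ^ θ₂ * E₂ ^ (1 - θ₂)) * (S₃ ^ θ₃ * E₃ ^ (1 - θ₃))) *
      ((S₁ / E₁) ^ θ₁ * ((S₂ / E₂) ^ θ₂ * (S₃ / E₃) ^ θ₃) / δ) ^ c := by
  have key : ∀ {S E θ : ℝ}, 0 < S → 0 < E → 0 ≤ (1 + c) * θ → (1 + c) * θ ≤ 1 →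
      min (δ * E) S ≤ Real.exp ((1 - (1 + c) * θ) * (Real.log δ + Real.log E) +
        (1 + c) * θ * Real.log S) := by
    intro S E θ hS hE h h'
    refine (min_le_rpow_mul_rpow (by positivity) hS h h').trans_eq ?_
    rw [Real.rpow_def_of_pos (by positivity), Real.rpow_def_of_pos hS, ← Real.exp_add,
      Real.log_mul hδ.ne' hE.ne']
    ring_nf
  have k₁ := key hS₁ hE₁ h₁ h₁'
  have k₂ := key hS₂ hE₂ h₂ h₂'
  have k₃ := key hS₃ hE₃ h₃ h₃'
  have hθ : θ₃ = 1 - θ₁ - θ₂ := by linarith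
  have m₁ : 0 < min (δ * E₁) S₁ := lt_min (by positivity) hS₁
  have m₂ : 0 < min (δ * E₂) S₂ := lt_min (by positivity) hS₂
  have m₃ : 0 < min (δ * E₃) S₃ := lt_min (by positivity) hS₃
  have hd : (δ ^ 2)⁻¹ = Real.exp (-2 * Real.log δ) := by
    rw [← Real.exp_log (show 0 < (δ ^ 2)⁻¹ by positivity), Real.log_inv, Real.log_pow]
    push_cast; ring_nf
  calc _ ≤ (δ ^ 2)⁻¹ * (_ * (_ * _)) :=
        mul_le_mul_of_nonneg_left (mul_le_mul k₁ (mul_le_mul k₂ k₃ m₃.le (Real.exp_pos _).le)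
          (by positivity) (Real.exp_pos _).le) (by positivity)
    _ = _ := by
      rw [Real.rpow_def_of_pos (show 0 < (S₁ / E₁) ^ θ₁ * ((S₂ / E₂) ^ θ₂ * (S₃ / E₃) ^ θ₃) / δ by
          positivity),
        Real.log_div (by positivity) hδ.ne', Real.log_mul (by positivity) (by positivity),
        Real.log_mul (by positivity) (by positivity), Real.log_rpow (by positivity),
        Real.log_rpow (by positivity), Real.log_rpow (by positivity),
        Real.log_div hS₁.ne' hE₁.ne', Real.log_div hS₂.ne' hE₂.ne', Real.log_div hS₃.ne' hE₃.ne',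
        hd]
      simp only [Real.rpow_def_of_pos, hS₁, hS₂, hS₃, hE₁, hE₂, hE₃, ← Real.exp_add]
      congr 1
      subst hθ
      ring

lemma summable_pow_natAbs {r : ℝ} (h0 : 0 ≤ r) (h1 : r < 1) :
    Summable (fun m : ℤ => r ^ m.natAbs) := by
  refine Summable.of_nat_of_neg ?_ ?_ <;>
  · simpa using summable_geometric_of_lt_one h0 h1

lemma exists_sum_min_rpow_le {ε : ℝ} (hε : 0 < ε) : ∃ C : ℝ, ∀ Y : ℝ, 0 < Y → ∀ M : ℕ,
    ∑ t ∈ Finset.range M, min ((Y * 2 ^ t) ^ ε) ((Y * 2 ^ t) ^ (-ε)) ≤ C := by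
  set r : ℝ := (2:ℝ) ^ (-ε) with hr
  have hr0 : 0 < r := by positivity
  have hr1 : r < 1 := Real.rpow_lt_one_of_one_lt_of_neg (by norm_num) (by linarith)
  have hsummable := summable_pow_natAbs hr0.le hr1
  refine ⟨2 ^ ε * ∑' m : ℤ, r ^ m.natAbs, fun Y hY M => ?_⟩
  obtain ⟨p, hp1, hp2⟩ := exists_mem_Ico_zpow hY (one_lt_two)
  have bound : ∀ t : ℕ, min ((Y * 2 ^ t) ^ ε) ((Y * 2 ^ t) ^ (-ε)) ≤
      2 ^ ε * r ^ (p + t).natAbs := by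
    intro t
    have lo : (2:ℝ) ^ ((p + t : ℤ) : ℝ) ≤ Y * 2 ^ t := by
      rw [Real.rpow_intCast, zpow_add₀ two_ne_zero, zpow_natCast]
      gcongr
    have hi : Y * 2 ^ t ≤ (2:ℝ) ^ ((p + t + 1 : ℤ) : ℝ) := by
      rw [Real.rpow_intCast, show p + t + 1 = (p + 1) + (t : ℤ) by ring,
        zpow_add₀ two_ne_zero, zpow_natCast]
      gcongr
    have e : r ^ (p + t).natAbs = (2:ℝ) ^ (-ε * |((p + t : ℤ) : ℝ)|) := by
      rw [hr, ← Real.rpow_natCast, ← Real.rpow_mul (by norm_num)]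
      congr 2
      rw [Nat.cast_natAbs, Int.cast_abs]
    rw [e, ← Real.rpow_add (by norm_num)]
    rcases le_total 0 (p + t : ℤ) with h | h
    · refine (min_le_right _ _).trans ?_
      refine (Real.rpow_le_rpow_of_nonpos (by positivity) lo (by linarith)).trans ?_
      rw [← Real.rpow_mul (by norm_num)]
      refine Real.rpow_le_rpow_of_exponent_le (by norm_num) ?_
      rw [abs_of_nonneg (by exact_mod_cast h)]
      linarith
    · refine (min_le_left _ _).trans ?_
      refine (Real.rpow_le_rpow (by positivity) hi hε.le).trans ?_
      rw [← Real.rpow_mul (by norm_num)]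
      refine Real.rpow_le_rpow_of_exponent_le (by norm_num) ?_
      rw [abs_of_nonpos (by exact_mod_cast h)]
      push_cast
      linarith
  refine (Finset.sum_le_sum fun t _ => bound t).trans ?_
  rw [← Finset.mul_sum]
  refine mul_le_mul_of_nonneg_left ?_ (by positivity)
  have hinj : Function.Injective (fun t : ℕ => p + (t : ℤ)) := fun a b h => by
    simpa using h
  have := hsummable.sum_le_tsum ((Finset.range M).map ⟨_, hinj⟩) (fun m _ => by positivity)
  rwa [Finset.sum_map] at this

/-- The trilinear estimate for collections whose scales all have the same parity. -/
lemma exists_trilinear_const {θ₁ θ₂ θ₃ : ℝ} (h1 : 0 ≤ θ₁) (h1' : θ₁ < 1)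
    (h2 : 0 ≤ θ₂) (h2' : θ₂ < 1) (h3 : 0 ≤ θ₃) (h3' : θ₃ < 1) (hsum : θ₁ + θ₂ + θ₃ = 1) :
    ∃ C : ℝ, ∀ (PP : Finset Quartile) (x y z : Quartile → ℝ) (S₁ S₂ S₃ E₁ E₂ E₃ : ℝ),
      (∀ P ∈ PP, ∀ P' ∈ PP, P.k % 2 = P'.k % 2) →
      0 < S₁ → 0 < S₂ → 0 < S₃ → 0 < E₁ → 0 < E₂ → 0 < E₃ →
      SizeLe PP 1 x S₁ → SizeLe PP 2 y S₂ → SizeLe PP 3 z S₃ →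
      EnergyLe PP 1 x E₁ → EnergyLe PP 2 y E₂ → EnergyLe PP 3 z E₃ →
      ∑ P ∈ PP, trilinearTerm x y z P ≤
        C * ((S₁ ^ θ₁ * E₁ ^ (1 - θ₁)) *
          ((S₂ ^ θ₂ * E₂ ^ (1 - θ₂)) * (S₃ ^ θ₃ * E₃ ^ (1 - θ₃)))) := by
  obtain ⟨ε, hε, hε₁, hε₂, hε₃⟩ : ∃ ε : ℝ, 0 < ε ∧ ε ≤ 1 - θ₁ ∧ ε ≤ 1 - θ₂ ∧ ε ≤ 1 - θ₃ :=
    ⟨min (1 - θ₁) (min (1 - θ₂) (1 - θ₃)), by simp [h1', h2', h3'], by simp, by simp, by simp⟩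
  obtain ⟨C, hC⟩ := exists_sum_min_rpow_le hε
  refine ⟨48 * C, fun PP x y z S₁ S₂ S₃ E₁ E₂ E₃ hpar hS₁ hS₂ hS₃ hE₁ hE₂ hE₃
    s₁ s₂ s₃ e₁ e₂ e₃ => ?_⟩
  set V := (S₁ ^ θ₁ * E₁ ^ (1 - θ₁)) *
    ((S₂ ^ θ₂ * E₂ ^ (1 - θ₂)) * (S₃ ^ θ₃ * E₃ ^ (1 - θ₃))) with hV
  set X := (S₁ / E₁) ^ θ₁ * ((S₂ / E₂) ^ θ₂ * (S₃ / E₃) ^ θ₃) with hX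
  have hV0 : 0 < V := by positivity
  have hX0 : 0 < X := by positivity
  set δ := S₁ / E₁ + S₂ / E₂ + S₃ / E₃ with hδdef
  have q₁ : 0 < S₁ / E₁ := by positivity
  have q₂ : 0 < S₂ / E₂ := by positivity
  have q₃ : 0 < S₃ / E₃ := by positivity
  have hδ : 0 < δ := by positivity
  have enlarge : ∀ {j : ℕ} {a : Quartile → ℝ} {S E : ℝ}, 0 < S → 0 < E → S / E ≤ δ →
      SizeLe PP j a S → SizeLe PP j a (δ * E) := by
    intro j a S E hS hE h hs i hi hij Q T hT htree
    refine (hs i hi hij Q T hT htree).trans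
      (mul_le_mul_of_nonneg_right (pow_le_pow_left₀ hS.le ?_ 2) Q.len_pos.le)
    rwa [div_le_iff₀ hE] at h
  have main := fun M : ℕ => trilinear_le_sum_levels hS₁ hS₂ hS₃ hE₁ hE₂ hE₃ M δ PP hδ hpar
    s₁ s₂ s₃ e₁ e₂ e₃ (enlarge hS₁ hE₁ (by linarith) s₁) (enlarge hS₂ hE₂ (by linarith) s₂)
    (enlarge hS₃ hE₃ (by linarith) s₃)
  have coeff : ∀ {θ : ℝ}, 0 ≤ θ → ε ≤ 1 - θ → (0 ≤ (1 + ε) * θ ∧ (1 + ε) * θ ≤ 1) ∧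
      0 ≤ (1 + -ε) * θ ∧ (1 + -ε) * θ ≤ 1 := by
    intro θ hθ h
    have b₁ : 0 ≤ ε * θ := mul_nonneg hε.le hθ
    have b₂ : ε * θ ≤ ε := mul_le_of_le_one_right hε.le (by linarith)
    have b₃ : ε * θ ≤ θ := mul_le_of_le_one_left hθ (by linarith)
    refine ⟨⟨?_, ?_⟩, ?_, ?_⟩ <;> linarith
  obtain ⟨⟨c₁, c₁'⟩, d₁, d₁'⟩ := coeff h1 hε₁
  obtain ⟨⟨c₂, c₂'⟩, d₂, d₂'⟩ := coeff h2 hε₂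
  obtain ⟨⟨c₃, c₃'⟩, d₃, d₃'⟩ := coeff h3 hε₃
  have level : ∀ t : ℕ, 48 * ((δ / 2 ^ t) ^ 2)⁻¹ *
      (min (δ / 2 ^ t * E₁) S₁ * (min (δ / 2 ^ t * E₂) S₂ * min (δ / 2 ^ t * E₃) S₃)) ≤
      48 * V * min ((X / δ * 2 ^ t) ^ ε) ((X / δ * 2 ^ t) ^ (-ε)) := by
    intro t
    have hXt : X / (δ / 2 ^ t) = X / δ * 2 ^ t := by field_simp
    have a₁ := level_le (δ := δ / 2 ^ t) (c := ε) hS₁ hS₂ hS₃ hE₁ hE₂ hE₃ (by positivity) hsum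
      c₁ c₁' c₂ c₂' c₃ c₃'
    have a₂ := level_le (δ := δ / 2 ^ t) (c := -ε) hS₁ hS₂ hS₃ hE₁ hE₂ hE₃ (by positivity) hsum
      d₁ d₁' d₂ d₂' d₃ d₃'
    rw [← hX, ← hV, hXt] at a₁ a₂
    rcases min_choice ((X / δ * 2 ^ t) ^ ε) ((X / δ * 2 ^ t) ^ (-ε)) with h | h <;> rw [h] <;>
      linarith
  have lim : Filter.Tendsto (fun M : ℕ => 48 * C * V +
      (δ / 2 ^ M * E₁) * ((δ / 2 ^ M * E₂) * (δ / 2 ^ M * E₃)) * ∑ P ∈ PP, P.len)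
      Filter.atTop (nhds (48 * C * V)) := by
    have hz : Filter.Tendsto (fun M : ℕ => δ / (2:ℝ) ^ M) Filter.atTop (nhds 0) :=
      tendsto_const_nhds.div_atTop (tendsto_pow_atTop_atTop_of_one_lt one_lt_two)
    have := ((hz.mul_const E₁).mul ((hz.mul_const E₂).mul (hz.mul_const E₃))).mul_const
      (∑ P ∈ PP, P.len)
    simpa using this.const_add (48 * C * V)
  refine ge_of_tendsto' lim fun M => (main M).trans ?_
  refine add_le_add_left ((Finset.sum_le_sum fun t _ => level t).trans ?_) _
  rw [← Finset.mul_sum]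
  have := mul_le_mul_of_nonneg_left (hC (X / δ) (by positivity) M)
    (show (0:ℝ) ≤ 48 * V by positivity)
  linarith

/-- The abstract trilinear size-energy estimate (Proposition `abstract`). -/
theorem abstract_trilinear (θ₁ θ₂ θ₃ : ℝ) (h1 : 0 ≤ θ₁) (h1' : θ₁ < 1)
    (h2 : 0 ≤ θ₂) (h2' : θ₂ < 1) (h3 : 0 ≤ θ₃) (h3' : θ₃ < 1)
    (hsum : θ₁ + θ₂ + θ₃ = 1) :
    ∃ C : ℝ, ∀ (PP : Finset Quartile) (F : ℕ → Quartile → ℝ → ℝ),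
      (∀ j P, Measurable (F j P)) →
      |∑ P ∈ PP, (Real.sqrt P.len)⁻¹ *
          (winner (F 1 P) (P.st 1) * (winner (F 2 P) (P.st 2) * winner (F 3 P) (P.st 3)))| ≤
        C * ((size PP 1 (fun P => winner (F 1 P) (P.st 1)) ^ θ₁ *
              energy PP 1 (fun P => winner (F 1 P) (P.st 1)) ^ (1 - θ₁)) *
             ((size PP 2 (fun P => winner (F 2 P) (P.st 2)) ^ θ₂ *
               energy PP 2 (fun P => winner (F 2 P) (P.st 2)) ^ (1 - θ₂)) *
              (size PP 3 (fun P => winner (F 3 P) (P.st 3)) ^ θ₃ *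
               energy PP 3 (fun P => winner (F 3 P) (P.st 3)) ^ (1 - θ₃)))) := by
  obtain ⟨C, hC⟩ := exists_trilinear_const h1 h1' h2 h2' h3 h3' hsum
  refine ⟨2 * C, fun PP F _ => ?_⟩
  set x := fun P => winner (F 1 P) (P.st 1) with hx
  set y := fun P => winner (F 2 P) (P.st 2) with hy
  set z := fun P => winner (F 3 P) (P.st 3) with hz
  have habs : |∑ P ∈ PP, (Real.sqrt P.len)⁻¹ * (x P * (y P * z P))| ≤
      ∑ P ∈ PP, trilinearTerm x y z P := by
    refine (Finset.abs_sum_le_sum_abs _ _).trans_eq (Finset.sum_congr rfl fun P _ => ?_)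
    rw [trilinearTerm, abs_mul, abs_mul, abs_mul, abs_of_nonneg (by positivity)]
  refine habs.trans ?_
  have s₁ := sizeLe_size PP 1 x
  have s₂ := sizeLe_size PP 2 y
  have s₃ := sizeLe_size PP 3 z
  have e₁ := energyLe_energy PP 1 x
  have e₂ := energyLe_energy PP 2 y
  have e₃ := energyLe_energy PP 3 z
  have hS₁ := size_nonneg PP 1 x
  have hS₂ := size_nonneg PP 2 y
  have hS₃ := size_nonneg PP 3 z
  have hE₁ := energy_nonneg PP 1 x
  have hE₂ := energy_nonneg PP 2 y
  have hE₃ := energy_nonneg PP 3 z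
  by_cases hzero : ∀ P ∈ PP, trilinearTerm x y z P = 0
  · rw [Finset.sum_eq_zero hzero]
    have hC0 : 0 ≤ C := by
      simpa [SizeLe, EnergyLe, fun Q : Quartile => Q.len_pos.le] using hC ∅ 0 0 0 1 1 1 1 1 1 (by simp)
    positivity
  push Not at hzero
  obtain ⟨P, hP, hne⟩ := hzero
  simp only [trilinearTerm, ne_eq, mul_eq_zero, not_or, abs_eq_zero] at hne
  obtain ⟨-, n₁, n₂, n₃⟩ := hne
  have pos_of_size : ∀ {s v : ℝ}, 0 ≤ s → v ≠ 0 → |v| ≤ Real.sqrt P.len * s → 0 < s := by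
    intro s v hs hv h
    refine hs.lt_of_ne fun h0 => hv ?_
    rw [← h0, mul_zero] at h
    exact abs_eq_zero.1 (le_antisymm h (abs_nonneg _))
  have S₁ := pos_of_size hS₁ n₁ (s₁.abs_le (i := 2) hS₁ (by simp) (by simp) hP)
  have S₂ := pos_of_size hS₂ n₂ (s₂.abs_le (i := 1) hS₂ (by simp) (by simp) hP)
  have S₃ := pos_of_size hS₃ n₃ (s₃.abs_le (i := 1) hS₃ (by simp) (by simp) hP)
  have E₁ := (abs_pos.2 n₁).trans_le (e₁.abs_le hE₁ hP)
  have E₂ := (abs_pos.2 n₂).trans_le (e₂.abs_le hE₂ hP)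
  have E₃ := (abs_pos.2 n₃).trans_le (e₃.abs_le hE₃ hP)
  have part : ∀ (p : Quartile → Prop) [DecidablePred p], (∀ P P', p P → p P' → P.k % 2 = P'.k % 2) →
      ∑ P ∈ PP.filter p, trilinearTerm x y z P ≤ _ := fun p _ hp =>
    hC (PP.filter p) x y z _ _ _ _ _ _
      (fun P hP P' hP' => hp P P' (Finset.mem_filter.1 hP).2 (Finset.mem_filter.1 hP').2)
      S₁ S₂ S₃ E₁ E₂ E₃ (s₁.mono (Finset.filter_subset _ _)) (s₂.mono (Finset.filter_subset _ _))
      (s₃.mono (Finset.filter_subset _ _)) (e₁.mono (Finset.filter_subset _ _))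
      (e₂.mono (Finset.filter_subset _ _)) (e₃.mono (Finset.filter_subset _ _))
  rw [← Finset.sum_filter_add_sum_filter_not PP (fun P => P.k % 2 = 0)]
  have p₁ := part (fun P => P.k % 2 = 0) fun P P' h h' => h.trans h'.symm
  have p₂ := part (fun P => ¬ P.k % 2 = 0) fun P P' h h' => by omega
  linarith

end
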